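/- Let G(q)=1/((q;q^5)_∞ (q^4;q^5)_∞) and H(q)=1/((q^2;q^5)_∞ (q^3;q^5)_∞) be the Rogers–Ramanujan functions and E(q)=(q;q)_∞. Then G(q)^2 H(q^2) + G(q^2) H(q)^2 = 2 G(q) G(q^2)^2 E(q^{10})^2/E(q^5)^2. -/

import Mathlib

/-- Euler's product E(q) = ∏_{k≥0} (1 - q^{k+1}). -/
noncomputable def E (q : ℂ) : ℂ := ∏' k : ℕ, (1 - q ^ (k + 1))

/-- q-Pochhammer infinite product (a;q)_∞ = ∏_{k≥0} (1 - a q^k). -/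
noncomputable def qp (a q : ℂ) : ℂ := ∏' k : ℕ, (1 - a * q ^ k)

/-- Rogers–Ramanujan function G(q) = 1/((q,q^4;q^5)_∞). -/
noncomputable def G (q : ℂ) : ℂ := 1 / (qp q (q ^ 5) * qp (q ^ 4) (q ^ 5))

/-- Rogers–Ramanujan function H(q) = 1/((q^2,q^3;q^5)_∞). -/
noncomputable def H (q : ℂ) : ℂ := 1 / (qp (q ^ 2) (q ^ 5) * qp (q ^ 3) (q ^ 5))

/-- Rogers–Ramanujan continued fraction product R(q). -/
noncomputable def R (q : ℂ) : ℂ :=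
  (qp q (q ^ 5) * qp (q ^ 4) (q ^ 5)) / (qp (q ^ 2) (q ^ 5) * qp (q ^ 3) (q ^ 5))

open Filter Topology

/-- Gaussian binomial coefficients, defined by the Pascal-type recurrence. -/
noncomputable def gaussBinom (p : ℂ) : ℕ → ℕ → ℂ
  | 0, 0 => 1
  | 0, _ + 1 => 0
  | n + 1, 0 => gaussBinom p n 0
  | n + 1, m + 1 => gaussBinom p n m + p ^ (m + 1) * gaussBinom p n (m + 1)

/-- The finite product `(p;p)_n`. -/
noncomputable def qFactorial (p : ℂ) (n : ℕ) : ℂ := ∏ k ∈ Finset.range n, (1 - p ^ (k + 1))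

/-- The term `p ^ (j (j - 1) / 2) * a ^ j` of the theta series. -/
noncomputable def thetaTerm (p a : ℂ) (j : ℤ) : ℂ := p ^ (j * (j - 1) / 2) * a ^ j

lemma gaussBinom_zero_right (p : ℂ) (n : ℕ) : gaussBinom p n 0 = 1 := by
  induction n with
  | zero => rfl
  | succ n ih => rw [gaussBinom, ih]

lemma gaussBinom_eq_zero (p : ℂ) {n m : ℕ} (h : n < m) : gaussBinom p n m = 0 := by
  induction n generalizing m with
  | zero =>
    obtain ⟨m, rfl⟩ := Nat.exists_eq_succ_of_ne_zero (by lia : m ≠ 0)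
    rfl
  | succ n ih =>
    obtain ⟨m, rfl⟩ := Nat.exists_eq_succ_of_ne_zero (by lia : m ≠ 0)
    rw [Nat.succ_eq_add_one, gaussBinom, ih (by lia), ih (by lia)]
    ring

lemma qFactorial_succ (p : ℂ) (n : ℕ) :
    qFactorial p (n + 1) = qFactorial p n * (1 - p ^ (n + 1)) :=
  Finset.prod_range_succ _ _

lemma gaussBinom_mul_qFactorial (p : ℂ) (N m k : ℕ) (h : m + k = N) :
    gaussBinom p N m * (qFactorial p m * qFactorial p k) = qFactorial p N := by
  induction N generalizing m k with
  | zero =>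
    obtain ⟨rfl, rfl⟩ : m = 0 ∧ k = 0 := by lia
    simp [gaussBinom, qFactorial]
  | succ N ih =>
    rcases m with _ | m
    · obtain rfl : k = N + 1 := by lia
      simp [gaussBinom_zero_right, qFactorial]
    · have h1 := ih m k (by lia)
      rcases k with _ | k
      · obtain rfl : m = N := by lia
        rw [gaussBinom, gaussBinom_eq_zero p (Nat.lt_succ_self m), qFactorial_succ p m]
        simp only [mul_zero, add_zero]
        linear_combination (1 - p ^ (m + 1)) * h1
      · have h2 := ih (m + 1) k (by lia)
        obtain rfl : N = m + k + 1 := by lia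
        rw [gaussBinom, qFactorial_succ p (m + k + 1)]
        rw [qFactorial_succ p k] at h1 ⊢
        rw [qFactorial_succ p m] at h2 ⊢
        linear_combination (1 - p ^ (m + 1)) * h1 + p ^ (m + 1) * (1 - p ^ (k + 1)) * h2

lemma two_mul_triangular (j : ℤ) : 2 * (j * (j - 1) / 2) = j * (j - 1) :=
  Int.mul_ediv_cancel' (Int.even_mul_pred_self j).two_dvd

lemma thetaTerm_zero (p a : ℂ) : thetaTerm p a 0 = 1 := by simp [thetaTerm]

lemma thetaTerm_add_one {p a : ℂ} (hp : p ≠ 0) (ha : a ≠ 0) (j : ℤ) :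
    thetaTerm p a (j + 1) = p ^ j * a * thetaTerm p a j := by
  have h : (j + 1) * (j + 1 - 1) / 2 = j + j * (j - 1) / 2 := by
    have := two_mul_triangular j
    have := two_mul_triangular (j + 1)
    lia
  rw [thetaTerm, thetaTerm, h, zpow_add₀ hp, zpow_add_one₀ ha]
  ring

lemma thetaTerm_mul_left (p a b : ℂ) (j : ℤ) :
    thetaTerm p (a * b) j = b ^ j * thetaTerm p a j := by
  rw [thetaTerm, thetaTerm, mul_zpow]
  ring

lemma thetaTerm_neg {p a : ℂ} (hp : p ≠ 0) (j : ℤ) :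
    thetaTerm p a (-j) = thetaTerm p (p / a) j := by
  have h : -j * (-j - 1) / 2 = j * (j - 1) / 2 + j := by
    have := two_mul_triangular j
    have := two_mul_triangular (-j)
    lia
  rw [thetaTerm, thetaTerm, h, zpow_add₀ hp, div_zpow, zpow_neg]
  ring

lemma thetaTerm_mul_thetaTerm {p a c : ℂ} (hp : p ≠ 0) (ha : a ≠ 0) (hc : c ≠ 0) (r s : ℤ) :
    thetaTerm p a (r + s) * thetaTerm p c (r - s) =
      thetaTerm (p ^ 2) (a * c) r * thetaTerm (p ^ 2) (p * a / c) s := by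
  have h : (r + s) * (r + s - 1) / 2 + (r - s) * (r - s - 1) / 2 =
      2 * (r * (r - 1) / 2) + (2 * (s * (s - 1) / 2) + s) := by
    have h1 := two_mul_triangular (r + s)
    have h2 := two_mul_triangular (r - s)
    have h3 := two_mul_triangular r
    have h4 := two_mul_triangular s
    linarith
  have h2 (j : ℤ) : (p ^ 2) ^ j = p ^ (2 * j) := by
    rw [zpow_mul]
    norm_cast
  simp only [thetaTerm, h2]
  calc _ = p ^ ((r + s) * (r + s - 1) / 2 + (r - s) * (r - s - 1) / 2) *
        (a ^ (r + s) * c ^ (r - s)) := by rw [zpow_add₀ hp]; ring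
    _ = _ := by
      rw [h, zpow_add₀ hp, zpow_add₀ hp, zpow_add₀ ha, zpow_sub₀ hc, mul_zpow, div_zpow, mul_zpow]
      ring

lemma prod_one_add_mul_pow {p : ℂ} (hp : p ≠ 0) (m : ℕ) (a : ℂ) (ha : a ≠ 0) :
    ∏ k ∈ Finset.range m, (1 + a * p ^ k) =
      ∑ i ∈ Finset.range (m + 1), gaussBinom p m i * thetaTerm p a i := by
  induction m generalizing a with
  | zero => simp [gaussBinom, thetaTerm_zero]
  | succ m ih =>
    have h1 : ∏ k ∈ Finset.range m, (1 + a * p ^ (k + 1)) =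
        ∑ i ∈ Finset.range (m + 1), gaussBinom p m i * thetaTerm p (a * p) i := by
      rw [← ih (a * p) (mul_ne_zero ha hp)]
      exact Finset.prod_congr rfl fun k _ => by ring
    have h2 : ∑ i ∈ Finset.range (m + 1), gaussBinom p m i * thetaTerm p (a * p) i =
        ∑ i ∈ Finset.range (m + 1), gaussBinom p m (i + 1) * thetaTerm p (a * p) (i + 1) + 1 := by
      have h3 := Finset.sum_range_succ (fun i : ℕ => gaussBinom p m i * thetaTerm p (a * p) i)
        (m + 1)
      rw [Finset.sum_range_succ' _ (m + 1)] at h3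
      simpa [gaussBinom_zero_right, thetaTerm_zero,
        gaussBinom_eq_zero p (Nat.lt_succ_self m)] using h3.symm
    rw [Finset.prod_range_succ', h1, pow_zero, mul_one, mul_add, mul_one]
    nth_rw 1 [h2]
    rw [Finset.sum_range_succ' _ (m + 1), Finset.sum_mul]
    simp only [gaussBinom_zero_right, Nat.cast_zero, thetaTerm_zero, mul_one, Nat.cast_add,
      Nat.cast_one]
    rw [add_right_comm, ← Finset.sum_add_distrib]
    congr 1
    refine Finset.sum_congr rfl fun i _ => ?_
    rw [gaussBinom, thetaTerm_mul_left, thetaTerm_mul_left, thetaTerm_add_one hp ha,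
      zpow_add_one₀ hp, zpow_natCast]
    ring

/-- The finite form of the Jacobi triple product. -/
lemma prod_one_add_mul_prod_one_add {p : ℂ} (hp : p ≠ 0) (m n : ℕ) (a : ℂ) (ha : a ≠ 0) :
    (∏ k ∈ Finset.range m, (1 + a * p ^ k)) * ∏ k ∈ Finset.range n, (1 + p / a * p ^ k) =
      ∑ i ∈ Finset.range (m + n + 1), gaussBinom p (m + n) i * thetaTerm p a ((i : ℤ) - n) := by
  induction n generalizing m a with
  | zero => simpa using prod_one_add_mul_pow hp m a ha
  | succ n ih =>
    have h := ih (m + 1) (a / p) (div_ne_zero ha hp)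
    have h1 : ∏ k ∈ Finset.range m, (1 + a / p * p ^ (k + 1)) =
        ∏ k ∈ Finset.range m, (1 + a * p ^ k) :=
      Finset.prod_congr rfl fun k _ => by rw [pow_succ]; field_simp
    have h2 : ∏ k ∈ Finset.range n, (1 + p / (a / p) * p ^ k) =
        ∏ k ∈ Finset.range n, (1 + p / a * p ^ (k + 1)) :=
      Finset.prod_congr rfl fun k _ => by rw [pow_succ]; field_simp
    rw [Finset.prod_range_succ', h1, h2] at h
    rw [Finset.prod_range_succ', show m + (n + 1) = m + 1 + n by ring]
    trans p / a * ∑ i ∈ Finset.range (m + 1 + n + 1),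
        gaussBinom p (m + 1 + n) i * thetaTerm p (a / p) ((i : ℤ) - n)
    · rw [← h]
      field_simp
      ring
    · rw [Finset.mul_sum]
      refine Finset.sum_congr rfl fun i _ => ?_
      have h3 : (i : ℤ) - n = ((i : ℤ) - (n + 1 : ℕ)) + 1 := by push_cast; ring
      rw [h3, div_eq_mul_inv a p, thetaTerm_mul_left, thetaTerm_add_one hp ha,
        zpow_add_one₀ (inv_ne_zero hp), inv_zpow]
      have := zpow_ne_zero ((i : ℤ) - (n + 1 : ℕ)) hp
      field_simp

lemma norm_pow_lt_one {p : ℂ} (hp1 : ‖p‖ < 1) {n : ℕ} (hn : n ≠ 0) : ‖p ^ n‖ < 1 := by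
  rw [norm_pow]
  exact pow_lt_one₀ (norm_nonneg _) hp1 hn

lemma summable_norm_mul_pow {p : ℂ} (hp1 : ‖p‖ < 1) (a : ℂ) :
    Summable fun k : ℕ => ‖a * p ^ k‖ := by
  simp only [norm_mul, norm_pow]
  exact (summable_geometric_of_lt_one (norm_nonneg _) hp1).mul_left _

lemma multipliable_one_sub_mul_pow {p : ℂ} (hp1 : ‖p‖ < 1) (a : ℂ) :
    Multipliable fun k : ℕ => 1 - a * p ^ k := by
  simpa [sub_eq_add_neg] using
    multipliable_one_add_of_summable (f := fun k : ℕ => -(a * p ^ k))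
      (by simpa only [norm_neg] using summable_norm_mul_pow hp1 a)

lemma qp_ne_zero {p : ℂ} (hp1 : ‖p‖ < 1) {a : ℂ} (ha : ‖a‖ < 1) : qp a p ≠ 0 := by
  have := tprod_one_add_ne_zero_of_summable (f := fun k : ℕ => -(a * p ^ k)) (fun k h => by
      have h1 : a * p ^ k = 1 := by linear_combination -h
      have h2 : ‖a * p ^ k‖ < 1 := by
        rw [norm_mul, norm_pow]
        exact mul_lt_one_of_nonneg_of_lt_one_left (norm_nonneg _) ha
          (pow_le_one₀ (norm_nonneg _) hp1.le)
      rw [h1, norm_one] at h2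
      exact lt_irrefl _ h2)
    (by simpa only [norm_neg] using summable_norm_mul_pow hp1 a)
  simpa [qp, sub_eq_add_neg] using this

lemma E_eq_qp (p : ℂ) : E p = qp p p := by
  simp only [E, qp, pow_succ']

lemma qp_mul_qp_neg {p : ℂ} (hp1 : ‖p‖ < 1) (a : ℂ) :
    qp a p * qp (-a) p = qp (a ^ 2) (p ^ 2) := by
  rw [qp, qp, qp, ← (multipliable_one_sub_mul_pow hp1 a).tprod_mul
    (multipliable_one_sub_mul_pow hp1 (-a))]
  exact tprod_congr fun k => by ring

lemma qp_eq_mul_sq {p : ℂ} (hp1 : ‖p‖ < 1) (a : ℂ) :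
    qp a p = qp a (p ^ 2) * qp (a * p) (p ^ 2) := by
  have hp2 := norm_pow_lt_one hp1 two_ne_zero
  have h (k : ℕ) : 1 - a * (p ^ 2) ^ k = 1 - a * p ^ (2 * k) := by ring
  have h' (k : ℕ) : 1 - a * p * (p ^ 2) ^ k = 1 - a * p ^ (2 * k + 1) := by ring
  have m1 := multipliable_one_sub_mul_pow hp2 a
  have m2 := multipliable_one_sub_mul_pow hp2 (a * p)
  simp only [h, h'] at m1 m2
  rw [qp, qp, qp]
  simp only [h, h']
  exact (tprod_even_mul_odd (f := fun k => 1 - a * p ^ k) m1 m2).symm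

lemma tendsto_prod_qp {p : ℂ} (hp1 : ‖p‖ < 1) (a : ℂ) :
    Tendsto (fun n => ∏ k ∈ Finset.range n, (1 - a * p ^ k)) atTop (𝓝 (qp a p)) :=
  (multipliable_one_sub_mul_pow hp1 a).tendsto_prod_tprod_nat

lemma tendsto_qFactorial {p : ℂ} (hp1 : ‖p‖ < 1) :
    Tendsto (qFactorial p) atTop (𝓝 (E p)) := by
  rw [E_eq_qp]
  refine (tendsto_prod_qp hp1 p).congr fun n => ?_
  simp only [qFactorial, pow_succ']

lemma qFactorial_ne_zero {p : ℂ} (hp1 : ‖p‖ < 1) (n : ℕ) : qFactorial p n ≠ 0 := by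
  refine Finset.prod_ne_zero_iff.2 fun k _ h => ?_
  have h1 := norm_pow_lt_one hp1 k.succ_ne_zero
  rw [Nat.succ_eq_add_one, ← sub_eq_zero.1 h, norm_one] at h1
  exact lt_irrefl _ h1

lemma E_ne_zero {p : ℂ} (hp1 : ‖p‖ < 1) : E p ≠ 0 := by
  rw [E_eq_qp]
  exact qp_ne_zero hp1 hp1

lemma gaussBinom_add {p : ℂ} (hp1 : ‖p‖ < 1) (m k : ℕ) :
    gaussBinom p (m + k) m = qFactorial p (m + k) * (qFactorial p m)⁻¹ * (qFactorial p k)⁻¹ := by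
  have h1 := qFactorial_ne_zero hp1 m
  have h2 := qFactorial_ne_zero hp1 k
  rw [← gaussBinom_mul_qFactorial p (m + k) m k rfl]
  field_simp

lemma exists_norm_gaussBinom_le {p : ℂ} (hp1 : ‖p‖ < 1) :
    ∃ C, ∀ n m, ‖gaussBinom p n m‖ ≤ C := by
  obtain ⟨C, hC⟩ := (Metric.isBounded_range_of_tendsto _ (tendsto_qFactorial hp1)).exists_norm_le
  obtain ⟨D, hD⟩ := (Metric.isBounded_range_of_tendsto _
    ((tendsto_qFactorial hp1).inv₀ (E_ne_zero hp1))).exists_norm_le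
  simp only [Set.forall_mem_range] at hC hD
  have hC0 : 0 ≤ C := (norm_nonneg _).trans (hC 0)
  have hD0 : 0 ≤ D := (norm_nonneg _).trans (hD 0)
  refine ⟨C * D * D, fun n m => ?_⟩
  rcases lt_or_ge n m with h | h
  · rw [gaussBinom_eq_zero p h, norm_zero]
    positivity
  · obtain ⟨k, rfl⟩ := Nat.exists_eq_add_of_le h
    rw [gaussBinom_add hp1, norm_mul, norm_mul]
    gcongr
    exacts [hC _, hD _, hD _]

lemma summable_norm_thetaTerm_nat {p a : ℂ} (hp : p ≠ 0) (hp1 : ‖p‖ < 1) (ha : a ≠ 0) :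
    Summable fun n : ℕ => ‖thetaTerm p a n‖ := by
  have hne (n : ℕ) : thetaTerm p a n ≠ 0 :=
    mul_ne_zero (zpow_ne_zero _ hp) (zpow_ne_zero _ ha)
  refine summable_of_ratio_test_tendsto_lt_one (l := 0) zero_lt_one
    (Eventually.of_forall fun n => norm_ne_zero_iff.2 (hne n)) ?_
  have h : Tendsto (fun n : ℕ => ‖p‖ ^ n * ‖a‖) atTop (𝓝 0) := by
    simpa using (tendsto_pow_atTop_nhds_zero_of_lt_one (norm_nonneg p) hp1).mul_const ‖a‖
  refine h.congr fun n => ?_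
  have := norm_ne_zero_iff.2 (hne n)
  rw [norm_norm, norm_norm, Nat.cast_succ, thetaTerm_add_one hp ha, norm_mul, norm_mul,
    zpow_natCast, norm_pow]
  field_simp

lemma summable_norm_thetaTerm {p a : ℂ} (hp : p ≠ 0) (hp1 : ‖p‖ < 1) (ha : a ≠ 0) :
    Summable fun j : ℤ => ‖thetaTerm p a j‖ := by
  refine Summable.of_nat_of_neg (summable_norm_thetaTerm_nat hp hp1 ha) ?_
  simp only [thetaTerm_neg hp]
  exact summable_norm_thetaTerm_nat hp hp1 (div_ne_zero hp ha)

lemma tendsto_gaussBinom_central {p : ℂ} (hp1 : ‖p‖ < 1) (j : ℤ) :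
    Tendsto (fun n : ℕ => gaussBinom p (n + n) (n + j).toNat) atTop (𝓝 (E p)⁻¹) := by
  have hE := E_ne_zero hp1
  have h1 : Tendsto (fun n : ℕ => n + n) atTop atTop :=
    tendsto_atTop_mono (fun n => Nat.le_add_left n n) tendsto_id
  have h2 (i : ℤ) : Tendsto (fun n : ℕ => ((n : ℤ) + i).toNat) atTop atTop :=
    tendsto_atTop.2 fun b => by
      filter_upwards [eventually_ge_atTop (b + i.natAbs)] with n hn
      lia
  have hP := tendsto_qFactorial hp1
  have h := ((hP.comp h1).mul ((hP.comp (h2 j)).inv₀ hE)).mul ((hP.comp (h2 (-j))).inv₀ hE)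
  rw [show (E p)⁻¹ = E p * (E p)⁻¹ * (E p)⁻¹ by field_simp]
  refine h.congr' ?_
  filter_upwards [eventually_ge_atTop j.natAbs] with n hn
  have h3 : n + n = ((n : ℤ) + j).toNat + ((n : ℤ) + -j).toNat := by lia
  simp only [Function.comp_apply]
  rw [h3, gaussBinom_add hp1]

/-- The Jacobi triple product identity. -/
theorem qp_mul_qp_mul_E {p : ℂ} (hp : p ≠ 0) (hp1 : ‖p‖ < 1) {a : ℂ} (ha : a ≠ 0) :
    qp (-a) p * qp (-(p / a)) p * E p = ∑' j : ℤ, thetaTerm p a j := by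
  have hE := E_ne_zero hp1
  obtain ⟨C, hC⟩ := exists_norm_gaussBinom_le hp1
  have hC0 : 0 ≤ C := (norm_nonneg _).trans (hC 0 0)
  let f : ℕ → ℤ → ℂ := fun n j => if j ∈ Finset.Icc (-(n : ℤ)) n then
    gaussBinom p (n + n) (n + j).toNat * thetaTerm p a j else 0
  have hf (n : ℕ) : ∑' j, f n j = (∏ k ∈ Finset.range n, (1 - -a * p ^ k)) *
      ∏ k ∈ Finset.range n, (1 - -(p / a) * p ^ k) := by
    simp only [neg_mul, sub_neg_eq_add]
    rw [prod_one_add_mul_prod_one_add hp n n a ha,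
      tsum_eq_sum (s := Finset.Icc (-(n : ℤ)) n) fun j hj => if_neg hj,
      Finset.sum_congr rfl fun j hj => if_pos hj]
    symm
    refine Finset.sum_nbij' (fun i : ℕ => (i : ℤ) - n) (fun j : ℤ => ((n : ℤ) + j).toNat)
      (fun i hi => ?_) (fun j hj => ?_) (fun i hi => ?_) (fun j hj => ?_) (fun i hi => ?_)
    · simp only [Finset.mem_range, Finset.mem_Icc] at *
      lia
    · simp only [Finset.mem_range, Finset.mem_Icc] at *
      lia
    · simp only [Finset.mem_range] at *
      lia
    · simp only [Finset.mem_Icc] at *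
      lia
    · simp
  have h1 : Tendsto (fun n => ∑' j, f n j) atTop
      (𝓝 (∑' j, (E p)⁻¹ * thetaTerm p a j)) := by
    refine tendsto_tsum_of_dominated_convergence
      ((summable_norm_thetaTerm hp hp1 ha).mul_left C) (fun j => ?_)
      (Eventually.of_forall fun n j => ?_)
    · refine ((tendsto_gaussBinom_central hp1 j).mul_const _).congr' ?_
      filter_upwards [eventually_ge_atTop j.natAbs] with n hn
      exact (if_pos (Finset.mem_Icc.2 (by lia))).symm
    · simp only [f]
      split_ifs
      · rw [norm_mul]
        gcongr
        exact hC _ _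
      · rw [norm_zero]
        positivity
  simp only [hf] at h1
  rw [tendsto_nhds_unique ((tendsto_prod_qp hp1 (-a)).mul (tendsto_prod_qp hp1 (-(p / a)))) h1,
    tsum_mul_left]
  field_simp

lemma tsum_thetaTerm_mul_add_tsum_thetaTerm_mul {p a c : ℂ} (hp : p ≠ 0) (hp1 : ‖p‖ < 1)
    (ha : a ≠ 0) (hc : c ≠ 0) :
    (∑' j, thetaTerm p a j) * (∑' j, thetaTerm p c j) +
        (∑' j, thetaTerm p (-a) j) * (∑' j, thetaTerm p (-c) j) =
      2 * ((∑' j, thetaTerm (p ^ 2) (a * c) j) * ∑' j, thetaTerm (p ^ 2) (p * a / c) j) := by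
  have s {p a : ℂ} (hp : p ≠ 0) (hp1 : ‖p‖ < 1) (ha : a ≠ 0) :=
    summable_norm_thetaTerm hp hp1 ha
  have hp2 := norm_pow_lt_one hp1 two_ne_zero
  have hp0 := pow_ne_zero 2 hp
  have ha' := neg_ne_zero.2 ha
  have hc' := neg_ne_zero.2 hc
  rw [tsum_mul_tsum_of_summable_norm (s hp hp1 ha) (s hp hp1 hc),
    tsum_mul_tsum_of_summable_norm (s hp hp1 ha') (s hp hp1 hc'),
    tsum_mul_tsum_of_summable_norm (s hp0 hp2 (mul_ne_zero ha hc))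
      (s hp0 hp2 (div_ne_zero (mul_ne_zero hp ha) hc)),
    ← (summable_mul_of_summable_norm (s hp hp1 ha) (s hp hp1 hc)).tsum_add
      (summable_mul_of_summable_norm (s hp hp1 ha') (s hp hp1 hc')), ← tsum_mul_left]
  have hneg (x : ℤ × ℤ) : thetaTerm p (-a) x.1 * thetaTerm p (-c) x.2 =
      (-1) ^ (x.1 + x.2) * (thetaTerm p a x.1 * thetaTerm p c x.2) := by
    rw [← mul_neg_one a, ← mul_neg_one c, thetaTerm_mul_left, thetaTerm_mul_left,
      zpow_add₀ (by norm_num)]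
    ring
  let g : ℤ × ℤ → ℤ × ℤ := fun x => (x.1 + x.2, x.1 - x.2)
  have hg : Function.Injective g := fun x y h => by
    simp only [g, Prod.mk.injEq] at h
    ext <;> lia
  rw [← hg.tsum_eq]
  · refine tsum_congr fun x => ?_
    rw [hneg, ← thetaTerm_mul_thetaTerm hp ha hc]
    have h : Even ((g x).1 + (g x).2) := ⟨x.1, by simp only [g]; ring⟩
    rw [h.neg_one_zpow]
    simp only [g]
    ring
  · intro x hx
    rcases Int.even_or_odd (x.1 + x.2) with h | h
    · obtain ⟨r, hr⟩ := h
      exact ⟨(r, r - x.2), Prod.ext (by simp only [g]; lia) (by simp only [g]; lia)⟩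
    · refine absurd ?_ hx
      simp only [hneg, h.neg_one_zpow]
      ring

/-- The product form of `tsum_thetaTerm_mul_add_tsum_thetaTerm_mul`. -/
lemma qp_mul_add_qp_mul {p a c : ℂ} (hp : p ≠ 0) (hp1 : ‖p‖ < 1) (ha : a ≠ 0) (hc : c ≠ 0) :
    (qp (-a) p * qp (-(p / a)) p * (qp c p * qp (p / c) p) +
        qp a p * qp (p / a) p * (qp (-c) p * qp (-(p / c)) p)) * E p ^ 2 =
      2 * (qp (a * c) (p ^ 2) * qp (p ^ 2 / (a * c)) (p ^ 2) *
        (qp (p * a / c) (p ^ 2) * qp (p * c / a) (p ^ 2))) * E (p ^ 2) ^ 2 := by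
  have hp2 := norm_pow_lt_one hp1 two_ne_zero
  have hp0 := pow_ne_zero 2 hp
  have h := tsum_thetaTerm_mul_add_tsum_thetaTerm_mul hp hp1 ha (neg_ne_zero.2 hc)
  rw [← qp_mul_qp_mul_E hp hp1 ha, ← qp_mul_qp_mul_E hp hp1 (neg_ne_zero.2 hc),
    ← qp_mul_qp_mul_E hp hp1 (neg_ne_zero.2 ha),
    ← qp_mul_qp_mul_E hp hp1 (neg_ne_zero.2 (neg_ne_zero.2 hc)),
    ← qp_mul_qp_mul_E hp0 hp2 (mul_ne_zero ha (neg_ne_zero.2 hc)),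
    ← qp_mul_qp_mul_E hp0 hp2 (div_ne_zero (mul_ne_zero hp ha) (neg_ne_zero.2 hc))] at h
  simp only [neg_neg, div_neg, mul_neg] at h
  rw [show p ^ 2 / (p * a / c) = p * c / a by field_simp] at h
  linear_combination h

lemma sum_inv_eq_of_theta_relation {A N B M Z e f : ℂ} (hA : A ≠ 0) (hN : N ≠ 0)
    (hM : M ≠ 0) (hZ : Z ≠ 0) (he : e ≠ 0) (hB : B = A * N * Z)
    (h : (N * B + A * M) * e ^ 2 = 2 * Z * (B * M) * f ^ 2) :
    (1 / A) ^ 2 * (1 / (B * M)) + 1 / (A * N) * (1 / B) ^ 2 =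
      2 * (1 / A) * (1 / (A * N)) ^ 2 * f ^ 2 / e ^ 2 := by
  have hB0 : B ≠ 0 := hB ▸ mul_ne_zero (mul_ne_zero hA hN) hZ
  trans (N * B + A * M) * e ^ 2 / (A ^ 2 * B ^ 2 * M * N * e ^ 2)
  · field_simp
  · rw [h, hB]
    field_simp

theorem stmt_2 : ∀ q : ℂ, ‖q‖ < 1 →
    G q ^ 2 * H (q ^ 2) + G (q ^ 2) * H q ^ 2
      = 2 * G q * G (q ^ 2) ^ 2 * E (q ^ 10) ^ 2 / E (q ^ 5) ^ 2 := by
  intro q hq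
  rcases eq_or_ne q 0 with rfl | hq0
  · norm_num [G, H, E, qp]
  have n5 : ‖q ^ 5‖ < 1 := norm_pow_lt_one hq (by norm_num)
  have h := qp_mul_add_qp_mul (pow_ne_zero 5 hq0) n5 hq0 (pow_ne_zero 2 hq0)
  rw [show q ^ 5 / q = q ^ 4 by field_simp, show q ^ 5 / q ^ 2 = q ^ 3 by field_simp,
    show q * q ^ 2 = q ^ 3 by ring, show (q ^ 5) ^ 2 = q ^ 10 by ring,
    show q ^ 10 / q ^ 3 = q ^ 7 by field_simp, show q ^ 5 * q / q ^ 2 = q ^ 4 by field_simp,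
    show q ^ 5 * q ^ 2 / q = q ^ 6 by field_simp] at h
  have n10 : ‖q ^ 10‖ < 1 := norm_pow_lt_one hq (by norm_num)
  have d1 := qp_mul_qp_neg n5 q
  have d2 := qp_mul_qp_neg n5 (q ^ 2)
  have d3 := qp_mul_qp_neg n5 (q ^ 3)
  have d4 := qp_mul_qp_neg n5 (q ^ 4)
  have e2 := qp_eq_mul_sq n5 (q ^ 2)
  have e3 := qp_eq_mul_sq n5 (q ^ 3)
  simp only [← pow_mul, ← pow_add, Nat.reduceMul, Nat.reduceAdd] at d1 d2 d3 d4 e2 e3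
  have hX : (qp q (q ^ 5) * qp (q ^ 4) (q ^ 5)) * (qp (-q) (q ^ 5) * qp (-q ^ 4) (q ^ 5)) =
      qp (q ^ 2) (q ^ 10) * qp (q ^ 8) (q ^ 10) := by
    rw [← d1, ← d4]
    ring
  have hY : (qp (q ^ 2) (q ^ 5) * qp (q ^ 3) (q ^ 5)) *
      (qp (-q ^ 2) (q ^ 5) * qp (-q ^ 3) (q ^ 5)) =
      qp (q ^ 4) (q ^ 10) * qp (q ^ 6) (q ^ 10) := by
    rw [← d2, ← d3]
    ring
  have hne {k : ℕ} (hk : k ≠ 0) {p : ℂ} (hp : ‖p‖ < 1) : qp (q ^ k) p ≠ 0 :=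
    qp_ne_zero hp (norm_pow_lt_one hq hk)
  have hX0 := mul_ne_zero (hne two_ne_zero n10) (hne (k := 8) (by norm_num) n10)
  have hY0 := mul_ne_zero (hne four_ne_zero n10) (hne (k := 6) (by norm_num) n10)
  have hZ0 := mul_ne_zero (hne three_ne_zero n10) (hne (k := 7) (by norm_num) n10)
  rw [← hX] at hX0
  rw [← hY] at hY0
  simp only [G, H, ← pow_mul, Nat.reduceMul]
  rw [← hX, ← hY]
  refine sum_inv_eq_of_theta_relation (left_ne_zero_of_mul hX0) (right_ne_zero_of_mul hX0)
    (right_ne_zero_of_mul hY0) hZ0 (E_ne_zero n5) ?_ ?_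
  · rw [hX, e2, e3]
    ring
  · rw [hY]
    linear_combination h
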